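/- arXiv:1812.08626 — 3 statements merged into one kernel-verified Lean document; each statement's English description precedes it below -/
import Mathlib

section
/- Let Ω be a measurable space and 𝒫 a nonempty family of probability measures on Ω. Let H be a family of measurable real-valued functions on Ω with sup_{P∈𝒫} E^P[|ξ|] < ∞ for each ξ ∈ H, and suppose H admits a countable dense subset H̃ = {ξ_m : m ∈ ℕ} ⊆ H, i.e., for every ξ ∈ H there exists a sequence (ζ_k) in H̃ with sup_{P∈𝒫} E^P[|ζ_k − ξ|] → 0 as k → ∞. Then the pointwise supremum η(ω) := sup_{m} ξ_m(ω) is an essential supremum of H in the quasi-surely sense; in particular, the essential supremum of H exists. -/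
open MeasureTheory Filter ENNReal

/-- A property holds quasi-surely w.r.t. a family `Ps` of measures if it holds
outside a polar set, i.e. a set that is null for every `P ∈ Ps`. -/
def QuasiSurely {Ω : Type*} [MeasurableSpace Ω] (Ps : Set (Measure Ω)) (p : Ω → Prop) : Prop :=
  ∃ N : Set Ω, (∀ P ∈ Ps, P N = 0) ∧ ∀ ω ∉ N, p ω

/-- `η` is an essential supremum, in the quasi-surely sense, of the family `H` of
measurable functions `Ω → [-∞, ∞]`. -/
def IsQSEssSup {Ω : Type*} [MeasurableSpace Ω] (Ps : Set (Measure Ω))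
    (H : Set (Ω → EReal)) (η : Ω → EReal) : Prop :=
  Measurable η ∧
  (∀ ξ ∈ H, QuasiSurely Ps (fun ω => ξ ω ≤ η ω)) ∧
  (∀ η' : Ω → EReal, Measurable η' →
    (∀ ξ ∈ H, QuasiSurely Ps (fun ω => ξ ω ≤ η' ω)) →
    QuasiSurely Ps (fun ω => η ω ≤ η' ω))

theorem quasiSurely_iff_forall_ae {Ω : Type*} [MeasurableSpace Ω] {Ps : Set (Measure Ω)}
    {p : Ω → Prop} : QuasiSurely Ps p ↔ ∀ P ∈ Ps, ∀ᵐ ω ∂P, p ω := by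
  refine ⟨?_, fun h => ⟨{ω | ¬ p ω}, fun P hP => ae_iff.1 (h P hP), fun ω hω => not_not.1 hω⟩⟩
  rintro ⟨N, hN, hp⟩ P hP
  filter_upwards [measure_eq_zero_iff_ae_notMem.1 (hN P hP)] with ω hω using hp ω hω

theorem ae_iInf_eq_zero_of_tendsto_lintegral {Ω : Type*} [MeasurableSpace Ω] {P : Measure Ω}
    {f : ℕ → Ω → ℝ≥0∞} (hf : ∀ k, Measurable (f k))
    (h : Tendsto (fun k => ∫⁻ ω, f k ω ∂P) atTop (nhds 0)) :
    ∀ᵐ ω ∂P, ⨅ k, f k ω = 0 := by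
  refine (lintegral_eq_zero_iff (Measurable.iInf hf)).1 (nonpos_iff_eq_zero.1 ?_)
  exact ge_of_tendsto' h fun k => lintegral_mono fun ω => iInf_le _ k

theorem coe_le_iSup_coe_of_iInf_nnnorm_sub_eq_zero {x : ℝ} {y : ℕ → ℝ} {φ : ℕ → ℕ}
    (h : ⨅ k, (‖y (φ k) - x‖₊ : ℝ≥0∞) = 0) : (x : EReal) ≤ ⨆ m, (y m : EReal) := by
  refine le_of_forall_lt fun c hc => ?_
  obtain ⟨z, hcz, hzx⟩ := EReal.lt_iff_exists_real_btwn.1 hc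
  have hzx : z < x := EReal.coe_lt_coe_iff.1 hzx
  have hpos : (0 : ℝ≥0∞) < ENNReal.ofReal (x - z) := ENNReal.ofReal_pos.2 (sub_pos.2 hzx)
  obtain ⟨k, hk⟩ := iInf_lt_iff.1 (h.trans_lt hpos)
  rw [← enorm_eq_nnnorm, ← ofReal_norm, ENNReal.ofReal_lt_ofReal_iff (sub_pos.2 hzx),
    Real.norm_eq_abs, abs_lt] at hk
  have hzy : z < y (φ k) := by linarith [hk.1]
  exact hcz.trans ((EReal.coe_lt_coe_iff.2 hzy).trans_le (le_iSup (fun m => (y m : EReal)) (φ k)))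

/-- If a family `H` of measurable real-valued functions with finite upper expectation
admits a countable dense subset `{ξs m : m ∈ ℕ} ⊆ H` (dense in the mean w.r.t. the
upper expectation), then the pointwise supremum of the `ξs m` is an essential supremum
of `H` in the quasi-surely sense; in particular the essential supremum of `H` exists. -/
theorem countable_dense_subset_pointwise_sup_isQSEssSup
    {Ω : Type*} [MeasurableSpace Ω] (Ps : Set (Measure Ω)) (hPs : Ps.Nonempty)
    (hprob : ∀ P ∈ Ps, IsProbabilityMeasure P)
    (H : Set (Ω → ℝ)) (hHmeas : ∀ ξ ∈ H, Measurable ξ)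
    (hHint : ∀ ξ ∈ H, (⨆ P ∈ Ps, ∫⁻ ω, ‖ξ ω‖₊ ∂P) < ⊤)
    (ξs : ℕ → Ω → ℝ) (hsub : ∀ m, ξs m ∈ H)
    (hdense : ∀ ξ ∈ H, ∃ φ : ℕ → ℕ,
      Tendsto (fun k => ⨆ P ∈ Ps, ∫⁻ ω, ‖ξs (φ k) ω - ξ ω‖₊ ∂P) atTop (nhds 0)) :
    IsQSEssSup Ps ((fun (f : Ω → ℝ) => (fun ω => ((f ω : ℝ) : EReal))) '' H)
      (fun ω => ⨆ m, ((ξs m ω : ℝ) : EReal)) := by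
  have hξs (m : ℕ) : Measurable (ξs m) := hHmeas _ (hsub m)
  refine ⟨Measurable.iSup fun m => (hξs m).coe_real_ereal, ?_, fun η' _ hη' => ?_⟩
  · rintro _ ⟨ξ, hξ, rfl⟩
    obtain ⟨φ, hφ⟩ := hdense ξ hξ
    refine quasiSurely_iff_forall_ae.2 fun P hP => ?_
    have hlim : Tendsto (fun k => ∫⁻ ω, ‖ξs (φ k) ω - ξ ω‖₊ ∂P) atTop (nhds 0) :=
      tendsto_of_tendsto_of_tendsto_of_le_of_le tendsto_const_nhds hφ
        (fun _ => bot_le) fun k =>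
          le_iSup₂ (f := fun P (_ : P ∈ Ps) => ∫⁻ ω, ‖ξs (φ k) ω - ξ ω‖₊ ∂P) P hP
    filter_upwards [ae_iInf_eq_zero_of_tendsto_lintegral
      (fun k => ((hξs (φ k)).sub (hHmeas ξ hξ)).nnnorm.coe_nnreal_ennreal) hlim] with ω hω
    exact coe_le_iSup_coe_of_iInf_nnnorm_sub_eq_zero hω
  · refine quasiSurely_iff_forall_ae.2 fun P hP => ?_
    have hle (m : ℕ) : ∀ᵐ ω ∂P, (ξs m ω : EReal) ≤ η' ω :=
      quasiSurely_iff_forall_ae.1 (hη' _ ⟨ξs m, hsub m, rfl⟩) P hP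
    filter_upwards [ae_all_iff.2 hle] with ω hω using iSup_le hω
end

section
/- Let Ω be a measurable space and 𝒫 a nonempty family of probability measures on Ω. Let (X_n) be a sequence of measurable functions Ω → [−∞,∞] and Y a measurable function such that E^P[Y] exists for every P ∈ 𝒫, inf_{P∈𝒫} E^P[Y] > −∞, and for every n, X_n ≥ Y quasi-surely. Then E^P[liminf_{n→∞} X_n] exists for every P ∈ 𝒫 and sup_{P∈𝒫} E^P[liminf_{n→∞} X_n] ≤ liminf_{n→∞} sup_{P∈𝒫} E^P[X_n] (Fatou's lemma for the upper expectation Ê[·] = sup_{P∈𝒫} E^P[·]). -/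
open MeasureTheory Filter ENNReal

/-- The positive part of an extended real, as an extended nonnegative real. -/
noncomputable def EReal.posPartENN (x : EReal) : ℝ≥0∞ :=
  if x = ⊤ then ⊤ else ENNReal.ofReal x.toReal

/-- The expectation `E^P[X]` of an `[-∞,∞]`-valued function, defined as
`∫ X⁺ dP - ∫ X⁻ dP` in the extended reals. -/
noncomputable def erealExp {Ω : Type*} [MeasurableSpace Ω] (P : Measure Ω)
    (X : Ω → EReal) : EReal :=
  ((∫⁻ ω, (X ω).posPartENN ∂P : ℝ≥0∞) : EReal) - ((∫⁻ ω, (-(X ω)).posPartENN ∂P : ℝ≥0∞) : EReal)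

/-- `E^P[X]` exists if at least one of `E^P[X⁺]`, `E^P[X⁻]` is finite. -/
def ErealExpExists {Ω : Type*} [MeasurableSpace Ω] (P : Measure Ω) (X : Ω → EReal) : Prop :=
  (∫⁻ ω, (X ω).posPartENN ∂P) < ⊤ ∨ (∫⁻ ω, (-(X ω)).posPartENN ∂P) < ⊤

theorem EReal.posPartENN_mono : Monotone EReal.posPartENN :=
  fun _ _ h => EReal.toENNReal_le_toENNReal h

theorem EReal.continuous_posPartENN : Continuous EReal.posPartENN :=
  EReal.continuous_toENNReal

theorem EReal.posPartENN_neg_antitone : Antitone fun x : EReal => (-x).posPartENN :=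
  fun _ _ h => EReal.posPartENN_mono (EReal.neg_le_neg_iff.2 h)

theorem EReal.continuous_posPartENN_neg : Continuous fun x : EReal => (-x).posPartENN :=
  EReal.continuous_posPartENN.comp continuous_neg

theorem EReal.liminf_coe_ennreal_sub_le (a b : ℕ → ℝ≥0∞) :
    ((liminf a atTop : ℝ≥0∞) : EReal) - ((limsup b atTop : ℝ≥0∞) : EReal) ≤
      liminf (fun n => (a n : EReal) - (b n : EReal)) atTop := by
  have ha : ((liminf a atTop : ℝ≥0∞) : EReal) = liminf (fun n => (a n : EReal)) atTop :=
    EReal.coe_ennreal_strictMono.monotone.map_liminf_of_continuousAt a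
      continuous_coe_ennreal_ereal.continuousAt
  have hb : -((limsup b atTop : ℝ≥0∞) : EReal) = liminf (-fun n => (b n : EReal)) atTop := by
    rw [EReal.liminf_neg]
    congr 1
    exact EReal.coe_ennreal_strictMono.monotone.map_limsup_of_continuousAt b
      continuous_coe_ennreal_ereal.continuousAt
  rw [sub_eq_add_neg, ha, hb]
  exact EReal.le_liminf_add

theorem lintegral_posPartENN_neg_ne_top_of_bot_lt_erealExp {Ω : Type*} [MeasurableSpace Ω]
    {P : Measure Ω} {Y : Ω → EReal} (h : ⊥ < erealExp P Y) :
    ∫⁻ ω, (-(Y ω)).posPartENN ∂P ≠ ⊤ := by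
  intro htop
  simp [erealExp, htop] at h

/-- Negative part of `liminf X n` is integrable when the `X n` are bounded below by a function
with integrable negative part. -/
theorem lintegral_posPartENN_neg_liminf_lt_top {Ω : Type*} [MeasurableSpace Ω] {P : Measure Ω}
    {X : ℕ → Ω → EReal} {Y : Ω → EReal} (hY : ∫⁻ ω, (-(Y ω)).posPartENN ∂P ≠ ⊤)
    (hdom : ∀ n, ∀ᵐ ω ∂P, Y ω ≤ X n ω) :
    ∫⁻ ω, (-(liminf (fun n => X n ω) atTop)).posPartENN ∂P < ⊤ := by
  refine lt_of_le_of_lt (lintegral_mono_ae ?_) hY.lt_top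
  filter_upwards [ae_all_iff.2 hdom] with ω hω
  exact EReal.posPartENN_neg_antitone (le_liminf_of_le (h := Eventually.of_forall hω))

/-- Fatou's lemma for the `EReal`-valued expectation. -/
theorem erealExp_liminf_le {Ω : Type*} [MeasurableSpace Ω] {P : Measure Ω}
    {X : ℕ → Ω → EReal} (hX : ∀ n, Measurable (X n)) {Y : Ω → EReal}
    (hY : ∫⁻ ω, (-(Y ω)).posPartENN ∂P ≠ ⊤) (hdom : ∀ n, ∀ᵐ ω ∂P, Y ω ≤ X n ω) :
    erealExp P (fun ω => liminf (fun n => X n ω) atTop) ≤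
      liminf (fun n => erealExp P (X n)) atTop := by
  have hpos : ∫⁻ ω, (liminf (fun n => X n ω) atTop).posPartENN ∂P ≤
      liminf (fun n => ∫⁻ ω, (X n ω).posPartENN ∂P) atTop := by
    refine le_trans (le_of_eq (lintegral_congr fun ω => ?_))
      (lintegral_liminf_le fun n => EReal.continuous_posPartENN.measurable.comp (hX n))
    exact EReal.posPartENN_mono.map_liminf_of_continuousAt (fun n => X n ω)
      EReal.continuous_posPartENN.continuousAt
  have hneg : limsup (fun n => ∫⁻ ω, (-(X n ω)).posPartENN ∂P) atTop ≤
      ∫⁻ ω, (-(liminf (fun n => X n ω) atTop)).posPartENN ∂P := by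
    refine (limsup_lintegral_le (fun ω => (-(Y ω)).posPartENN)
      (fun n => EReal.continuous_posPartENN_neg.measurable.comp (hX n))
      (fun n => (hdom n).mono fun ω hω => EReal.posPartENN_neg_antitone hω) hY).trans
      (le_of_eq (lintegral_congr fun ω => ?_))
    exact (EReal.posPartENN_neg_antitone.map_liminf_of_continuousAt (fun n => X n ω)
      EReal.continuous_posPartENN_neg.continuousAt).symm
  exact (EReal.sub_le_sub (EReal.coe_ennreal_le_coe_ennreal_iff.2 hpos)
    (EReal.coe_ennreal_le_coe_ennreal_iff.2 hneg)).trans (EReal.liminf_coe_ennreal_sub_le _ _)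

theorem QuasiSurely.ae {Ω : Type*} [MeasurableSpace Ω] {Ps : Set (Measure Ω)} {p : Ω → Prop}
    (h : QuasiSurely Ps p) {P : Measure Ω} (hP : P ∈ Ps) : ∀ᵐ ω ∂P, p ω := by
  obtain ⟨N, hN, hp⟩ := h
  exact measure_mono_null (fun ω hω => by_contra fun hn => hω (hp ω hn)) (hN P hP)

/-- Fatou's lemma for the upper expectation `Ê[·] = sup_{P∈Ps} E^P[·]`: if the
sequence `(X n)` is bounded below quasi-surely by some `Y` whose expectation exists
for every `P ∈ Ps` with `inf_{P∈Ps} E^P[Y] > -∞`, then `E^P[liminf X n]` exists for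
every `P ∈ Ps` and `Ê[liminf X n] ≤ liminf Ê[X n]`. -/
theorem fatou_upper_expectation
    {Ω : Type*} [MeasurableSpace Ω] (Ps : Set (Measure Ω)) (hPs : Ps.Nonempty)
    (hprob : ∀ P ∈ Ps, IsProbabilityMeasure P)
    (X : ℕ → Ω → EReal) (hX : ∀ n, Measurable (X n))
    (Y : Ω → EReal) (hY : Measurable Y)
    (hYex : ∀ P ∈ Ps, ErealExpExists P Y)
    (hYbd : ⊥ < ⨅ P ∈ Ps, erealExp P Y)
    (hdom : ∀ n, QuasiSurely Ps (fun ω => Y ω ≤ X n ω)) :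
    (∀ P ∈ Ps, ErealExpExists P (fun ω => Filter.liminf (fun n => X n ω) Filter.atTop)) ∧
    (⨆ P ∈ Ps, erealExp P (fun ω => Filter.liminf (fun n => X n ω) Filter.atTop)) ≤
      Filter.liminf (fun n => ⨆ P ∈ Ps, erealExp P (X n)) Filter.atTop := by
  have hY' : ∀ P ∈ Ps, ∫⁻ ω, (-(Y ω)).posPartENN ∂P ≠ ⊤ := fun P hP =>
    lintegral_posPartENN_neg_ne_top_of_bot_lt_erealExp (hYbd.trans_le (iInf₂_le P hP))
  refine ⟨fun P hP => Or.inr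
    (lintegral_posPartENN_neg_liminf_lt_top (hY' P hP) fun n => (hdom n).ae hP), ?_⟩
  refine iSup₂_le fun P hP =>
    (erealExp_liminf_le hX (hY' P hP) fun n => (hdom n).ae hP).trans ?_
  exact liminf_le_liminf (Eventually.of_forall fun n =>
    le_iSup₂ (f := fun P (_ : P ∈ Ps) => erealExp P (X n)) P hP)
end

section
/- Convergence of dyadic approximate hitting times: let A : [0,1] → ℝ be continuous with A(t) ≥ 0 for all t ∈ [0,1] and A(1) = 0. For n ∈ ℕ and ε > 0 set τ_ε^n := min{ t ∈ I_n : A(t) ≤ ε } where I_n = { k/2^n : k = 0,1,…,2^n }, set τ_ε := inf{ t ∈ I : A(t) ≤ ε } where I = ⋃_n I_n, and set τ := inf{ t ∈ [0,1] : A(t) = 0 }. Then τ_ε^n is nonincreasing in n and nonincreasing in ε, lim_{n→∞} τ_ε^n = τ_ε for each ε > 0, and lim_{ε→0⁺} τ_ε = τ; in particular lim_{ε→0⁺} lim_{n→∞} τ_ε^n = τ. -/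
open Filter Topology

/-- Every nonnegative real is the limit of its dyadic truncations. -/
theorem tendsto_dyadic_floor {t : ℝ} (ht : 0 ≤ t) :
    Tendsto (fun n : ℕ => (⌊t * 2 ^ n⌋₊ : ℝ) / 2 ^ n) atTop (𝓝 t) :=
  (tendsto_nat_floor_mul_div_atTop ht).comp (tendsto_pow_atTop_atTop_of_one_lt one_lt_two)

theorem dyadic_floor_le {t : ℝ} (ht : 0 ≤ t) (n : ℕ) :
    (⌊t * 2 ^ n⌋₊ : ℝ) / 2 ^ n ≤ t := by
  rw [div_le_iff₀ (by positivity)]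
  exact Nat.floor_le (by positivity)

theorem dyadic_floor_numerator_le {t : ℝ} (ht : t ≤ 1) (n : ℕ) :
    ⌊t * 2 ^ n⌋₊ ≤ 2 ^ n := by
  refine Nat.floor_le_of_le ?_
  push_cast
  exact mul_le_of_le_one_left (by positivity) ht

/-- Convergence of dyadic approximate hitting times: let `A : [0,1] → ℝ` be continuous,
nonnegative on `[0,1]`, with `A 1 = 0`.  With `τn n ε` the first dyadic time of level
`n` at which `A ≤ ε`, `τe ε` the infimum over all dyadic times at which `A ≤ ε`, and
`τ` the first zero of `A`, one has: `τn · ε` is nonincreasing in `n` and in `ε`,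
`τn n ε → τe ε` as `n → ∞`, and `τe ε → τ` as `ε → 0⁺`. -/
theorem dyadic_hitting_times_converge
    (A : ℝ → ℝ) (hA : ContinuousOn A (Set.Icc 0 1))
    (hpos : ∀ t ∈ Set.Icc (0 : ℝ) 1, 0 ≤ A t) (h1 : A 1 = 0) :
    let In : ℕ → Set ℝ := fun n => {t | ∃ k : ℕ, k ≤ 2 ^ n ∧ t = (k : ℝ) / 2 ^ n}
    let τn : ℕ → ℝ → ℝ := fun n ε => sInf {t | t ∈ In n ∧ A t ≤ ε}
    let τe : ℝ → ℝ := fun ε => sInf {t | (t ∈ ⋃ n, In n) ∧ A t ≤ ε}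
    let τ : ℝ := sInf {t | t ∈ Set.Icc (0 : ℝ) 1 ∧ A t = 0}
    (∀ ε > (0 : ℝ), Antitone (fun n => τn n ε)) ∧
    (∀ n : ℕ, ∀ ε₁ ε₂ : ℝ, 0 < ε₁ → ε₁ ≤ ε₂ → τn n ε₂ ≤ τn n ε₁) ∧
    (∀ ε > (0 : ℝ), Tendsto (fun n => τn n ε) atTop (𝓝 (τe ε))) ∧
    Tendsto τe (𝓝[>] 0) (𝓝 τ) := by
  intro In τn τe τ
  have In_sub : ∀ n, In n ⊆ Set.Icc 0 1 := by
    rintro n t ⟨k, hk, rfl⟩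
    refine ⟨by positivity, div_le_one_of_le₀ ?_ (by positivity)⟩
    exact_mod_cast hk
  have In_mono : Monotone In := by
    refine monotone_nat_of_le_succ fun n => ?_
    rintro t ⟨k, hk, rfl⟩
    refine ⟨2 * k, by rw [pow_succ]; omega, ?_⟩
    push_cast
    rw [pow_succ]
    field_simp
  have one_mem : ∀ n, (1 : ℝ) ∈ In n := fun n => ⟨2 ^ n, le_rfl, by simp⟩
  have bdd_n : ∀ n ε, BddBelow {t | t ∈ In n ∧ A t ≤ ε} :=
    fun n ε => ⟨0, fun t ht => (In_sub n ht.1).1⟩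
  have iUnion_sub : (⋃ n, In n) ⊆ Set.Icc 0 1 := Set.iUnion_subset In_sub
  have bdd_e : ∀ ε, BddBelow {t | (t ∈ ⋃ n, In n) ∧ A t ≤ ε} :=
    fun ε => ⟨0, fun t ht => (iUnion_sub ht.1).1⟩
  have ne_n : ∀ n ε, 0 < ε → {t | t ∈ In n ∧ A t ≤ ε}.Nonempty :=
    fun n ε hε => ⟨1, one_mem n, h1.trans_le hε.le⟩
  have ne_e : ∀ ε, 0 < ε → {t | (t ∈ ⋃ n, In n) ∧ A t ≤ ε}.Nonempty :=
    fun ε hε => ⟨1, Set.mem_iUnion.2 ⟨0, one_mem 0⟩, h1.trans_le hε.le⟩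
  refine ⟨fun ε hε m n hmn => ?_, fun n ε₁ ε₂ hε h => ?_, fun ε hε => ?_, ?_⟩
  · exact csInf_le_csInf (bdd_n n ε) (ne_n m ε hε) fun t ht => ⟨In_mono hmn ht.1, ht.2⟩
  · exact csInf_le_csInf (bdd_n n ε₂) (ne_n n ε₁ hε) fun t ht => ⟨ht.1, ht.2.trans h⟩
  · refine tendsto_order.2 ⟨fun a ha => ?_, fun a ha => ?_⟩
    · refine Eventually.of_forall fun n => ha.trans_le ?_
      exact csInf_le_csInf (bdd_e ε) (ne_n n ε hε)
        fun t ht => ⟨Set.mem_iUnion.2 ⟨n, ht.1⟩, ht.2⟩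
    · obtain ⟨t, ⟨ht, htε⟩, hta⟩ := exists_lt_of_csInf_lt (ne_e ε hε) ha
      obtain ⟨N, hN⟩ := Set.mem_iUnion.1 ht
      filter_upwards [eventually_ge_atTop N] with n hn
      exact (csInf_le (bdd_n n ε) ⟨In_mono hn hN, htε⟩).trans_lt hta
  · have bdd_zero : BddBelow {t | t ∈ Set.Icc (0 : ℝ) 1 ∧ A t = 0} := ⟨0, fun t ht => ht.1.1⟩
    have τ_mem : τ ∈ {t | t ∈ Set.Icc (0 : ℝ) 1 ∧ A t = 0} :=
      (hA.preimage_isClosed_of_isClosed isClosed_Icc isClosed_singleton).csInf_mem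
        ⟨1, ⟨zero_le_one, le_rfl⟩, h1⟩ bdd_zero
    refine tendsto_order.2 ⟨fun a ha => ?_, fun a ha => ?_⟩
    · obtain ⟨b, hab, hbτ⟩ := exists_between ha
      have hb1 : b ≤ 1 := hbτ.le.trans τ_mem.1.2
      obtain hb | hb := lt_or_ge b 0
      · filter_upwards [self_mem_nhdsWithin] with ε hε
        exact (hab.trans hb).trans_le
          (le_csInf (ne_e ε hε) fun t ht => (iUnion_sub ht.1).1)
      · obtain ⟨x, hx, hmin⟩ := isCompact_Icc.exists_isMinOn (Set.nonempty_Icc.2 hb)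
          (hA.mono (Set.Icc_subset_Icc_right hb1))
        have hx1 : x ∈ Set.Icc (0 : ℝ) 1 := ⟨hx.1, hx.2.trans hb1⟩
        have hAx : 0 < A x := (hpos x hx1).lt_of_ne' fun h0 =>
          (hx.2.trans_lt hbτ).not_ge (csInf_le bdd_zero ⟨hx1, h0⟩)
        filter_upwards [Ioo_mem_nhdsGT hAx] with ε hε
        refine hab.trans_le (le_csInf (ne_e ε hε.1) fun t ht => ?_)
        by_contra! htb
        exact (ht.2.trans_lt hε.2).not_ge (hmin ⟨(iUnion_sub ht.1).1, htb.le⟩)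
    · filter_upwards [self_mem_nhdsWithin] with ε hε
      refine lt_of_le_of_lt ?_ ha
      have floor_mem : ∀ n : ℕ, (⌊τ * 2 ^ n⌋₊ : ℝ) / 2 ^ n ∈ In n :=
        fun n => ⟨_, dyadic_floor_numerator_le τ_mem.1.2 n, rfl⟩
      have hlim : Tendsto (fun n : ℕ => A ((⌊τ * 2 ^ n⌋₊ : ℝ) / 2 ^ n)) atTop (𝓝 (A τ)) :=
        (hA τ τ_mem.1).tendsto.comp (tendsto_nhdsWithin_iff.2
          ⟨tendsto_dyadic_floor τ_mem.1.1, Eventually.of_forall fun n => In_sub n (floor_mem n)⟩)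
      rw [τ_mem.2] at hlim
      obtain ⟨n, hn⟩ := (hlim.eventually_lt_const hε).exists
      exact (csInf_le (bdd_e ε) ⟨Set.mem_iUnion.2 ⟨n, floor_mem n⟩, hn.le⟩).trans
        (dyadic_floor_le τ_mem.1.1 n)
end
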